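/- Let A be an abelian category, B a Serre subcategory, and π : A → A/B the quotient functor. If there exist objects G_B in B with thick(G_B) = B and an object G in A/B with thick(G) = A/B, then for any object G' of A with π(G') ≅ G, the smallest thick subcategory of A containing G_B ⊕ G' is all of A. -/

import Mathlib

open CategoryTheory CategoryTheory.Limits

universe v u v' u'

variable {C : Type u} [Category.{v} C] [Abelian C]

/-- `X` is a retract (direct summand) of `B`. -/
def IsRetract {E : Type*} [Category E] (X B : E) : Prop :=
  ∃ (s : X ⟶ B) (r : B ⟶ X), s ≫ r = 𝟙 X

section Defs

variable {A : Type u'} [Category.{v'} A] [Abelian A]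

/-- A thick subcategory of an abelian category, given by its set of objects:
strictly full, additive, closed under direct summands, and with the
two-out-of-three property for short exact sequences. -/
structure IsThickAb (T : Set A) : Prop where
  mem_of_iso : ∀ {X Y : A}, (X ≅ Y) → X ∈ T → Y ∈ T
  zero_mem : ∀ {X : A}, IsZero X → X ∈ T
  retract_mem : ∀ {X B : A}, IsRetract X B → B ∈ T → X ∈ T
  mem₂ : ∀ (S : ShortComplex A), S.ShortExact → S.X₁ ∈ T → S.X₃ ∈ T → S.X₂ ∈ T
  mem₁ : ∀ (S : ShortComplex A), S.ShortExact → S.X₂ ∈ T → S.X₃ ∈ T → S.X₁ ∈ T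
  mem₃ : ∀ (S : ShortComplex A), S.ShortExact → S.X₁ ∈ T → S.X₂ ∈ T → S.X₃ ∈ T

/-- The smallest thick subcategory of an abelian category containing `S`. -/
def thickClosure (S : Set A) : Set A :=
  {X | ∀ T : Set A, IsThickAb T → S ⊆ T → X ∈ T}

/-- A Serre subcategory of an abelian category, given by its set of objects:
a nonempty full subcategory closed under subobjects, quotients and extensions. -/
structure IsSerre (B : Set A) : Prop where
  nonempty : B.Nonempty
  subobject_mem : ∀ {X Y : A} (f : X ⟶ Y), Mono f → Y ∈ B → X ∈ B
  quotient_mem : ∀ {X Y : A} (f : X ⟶ Y), Epi f → X ∈ B → Y ∈ B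
  extension_mem : ∀ (S : ShortComplex A), S.ShortExact → S.X₁ ∈ B → S.X₃ ∈ B → S.X₂ ∈ B

/-- The class of morphisms whose kernel and cokernel both lie in `B`.  The Serre
quotient `A ⥤ A/B` is precisely the localization of `A` at this class of morphisms,
so a functor `π : A ⥤ D` is (equivalent to) the Serre quotient functor if and only if
it is a localization functor with respect to `serreW B`. -/
def serreW (B : Set A) : MorphismProperty A :=
  fun _ _ f => Limits.kernel f ∈ B ∧ Limits.cokernel f ∈ B

/-- The image of a set of objects under a functor, up to isomorphism. -/
def imageSet {A' : Type*} [Category A'] (π : A ⥤ A') (T : Set A) : Set A' :=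
  {Y | ∃ X ∈ T, Nonempty (π.obj X ≅ Y)}

end Defs

variable {D : Type u'} [Category.{v'} D] [Abelian D]


section RelDefs

variable {A : Type u'} [Category.{v'} A] [Abelian A]

/-- A thick subcategory of the full abelian subcategory of `A` on the objects of the
ambient set `Amb` (for instance a Serre subcategory regarded as an abelian category),
given by its set of objects. -/
structure IsThickIn (Amb T : Set A) : Prop where
  subset : T ⊆ Amb
  mem_of_iso : ∀ {X Y : A}, (X ≅ Y) → X ∈ T → Y ∈ Amb → Y ∈ T
  zero_mem : ∀ {X : A}, IsZero X → X ∈ Amb → X ∈ T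
  retract_mem : ∀ {X B : A}, IsRetract X B → B ∈ T → X ∈ Amb → X ∈ T
  mem₂ : ∀ (S : ShortComplex A), S.ShortExact → S.X₂ ∈ Amb →
    S.X₁ ∈ T → S.X₃ ∈ T → S.X₂ ∈ T
  mem₁ : ∀ (S : ShortComplex A), S.ShortExact → S.X₁ ∈ Amb →
    S.X₂ ∈ T → S.X₃ ∈ T → S.X₁ ∈ T
  mem₃ : ∀ (S : ShortComplex A), S.ShortExact → S.X₃ ∈ Amb →
    S.X₁ ∈ T → S.X₂ ∈ T → S.X₃ ∈ T

/-- The smallest thick subcategory of the full abelian subcategory of `A` on `Amb`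
containing `S`. -/
def thickClosureIn (Amb S : Set A) : Set A :=
  {X | ∀ T : Set A, IsThickIn Amb T → S ⊆ T → X ∈ T}

end RelDefs

instance (priority := 100) : HasBinaryBiproducts C := by
  have : HasFiniteBiproducts C := HasFiniteBiproducts.of_hasFiniteProducts
  infer_instance

open scoped ZeroObject in
theorem serreClass_of_isSerre {B : Set C} (hB : IsSerre B) :
    ObjectProperty.IsSerreClass (fun X : C => X ∈ B) where
  exists_zero := by
    obtain ⟨X, hX⟩ := hB.nonempty
    exact ⟨0, isZero_zero C, hB.subobject_mem (0 : 0 ⟶ X) inferInstance hX⟩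
  prop_of_mono f hf h := hB.subobject_mem f hf h
  prop_of_epi f hf h := hB.quotient_mem f hf h
  prop_X₂_of_shortExact hS h1 h3 := hB.extension_mem _ hS h1 h3

theorem aux_preservesFiniteLimits (P : ObjectProperty C) [P.IsSerreClass] (π : C ⥤ D)
    [π.IsLocalization P.isoModSerre] : PreservesFiniteLimits π := by
  let := Localization.preadditive π P.isoModSerre
  have := Localization.functor_additive π P.isoModSerre
  exact ObjectProperty.SerreClassLocalization.preservesFiniteLimits π P

theorem aux_preservesFiniteColimits (P : ObjectProperty C) [P.IsSerreClass] (π : C ⥤ D)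
    [π.IsLocalization P.isoModSerre] : PreservesFiniteColimits π := by
  let := Localization.preadditive π P.isoModSerre
  have := Localization.functor_additive π P.isoModSerre
  exact ObjectProperty.SerreClassLocalization.preservesFiniteColimits π P

theorem aux_additive (P : ObjectProperty C) [P.IsSerreClass] (π : C ⥤ D)
    [π.IsLocalization P.isoModSerre] : π.Additive := by
  have := aux_preservesFiniteLimits P π
  have : π.PreservesZeroMorphisms := by
    have := aux_preservesFiniteColimits P π
    infer_instance
  exact π.additive_of_preserves_binary_products

theorem exists_shortExact_lift (P : ObjectProperty C) [P.IsSerreClass] (π : C ⥤ D)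
    [π.IsLocalization P.isoModSerre]
    (S : ShortComplex D) (hS : S.ShortExact) :
    ∃ S' : ShortComplex C, S'.ShortExact ∧ Nonempty (π.obj S'.X₁ ≅ S.X₁) ∧
      Nonempty (π.obj S'.X₂ ≅ S.X₂) ∧ Nonempty (π.obj S'.X₃ ≅ S.X₃) := by
  have := aux_additive P π
  have := aux_preservesFiniteLimits P π
  have := aux_preservesFiniteColimits P π
  obtain ⟨X', Y', f', _, ⟨e⟩⟩ :=
    (ObjectProperty.SerreClassLocalization.mono_iff π P S.f).1 hS.mono_f
  let S' : ShortComplex C := ShortComplex.mk f' (cokernel.π f') (by simp)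
  have hS' : S'.ShortExact :=
    { exact := S'.exact_of_g_is_cokernel (cokernelIsCokernel f')
      mono_f := inferInstanceAs (Mono f')
      epi_g := inferInstanceAs (Epi (cokernel.π f')) }
  refine ⟨S', hS', ⟨Arrow.leftFunc.mapIso e⟩, ⟨Arrow.rightFunc.mapIso e⟩, ⟨?_⟩⟩
  exact CokernelCofork.mapIsoOfIsColimit (hS'.map_of_exact π).gIsCokernel hS.gIsCokernel e

/-- If the kernel and cokernel of `f` lie in a thick `T`, then source and target of `f` lie
in `T` simultaneously. -/
theorem mem_iff_of_ker_coker {T : Set C} (hT : IsThickAb T) {X Y : C} (f : X ⟶ Y)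
    (hk : kernel f ∈ T) (hc : cokernel f ∈ T) : X ∈ T ↔ Y ∈ T := by
  let S₁ : ShortComplex C :=
    ShortComplex.mk (kernel.ι f) (Abelian.factorThruImage f)
      (by rw [← cancel_mono (Abelian.image.ι f)]; simp)
  have h₁ : S₁.ShortExact :=
    { exact := by
        have h : (ShortComplex.mk (kernel.ι f) f (kernel.condition f)).Exact :=
          ShortComplex.exact_of_f_is_kernel _ (kernelIsKernel f)
        let φ : S₁ ⟶ ShortComplex.mk (kernel.ι f) f (kernel.condition f) :=
          { τ₁ := 𝟙 _, τ₂ := 𝟙 _, τ₃ := Abelian.image.ι f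
            comm₁₂ := by simp [S₁]
            comm₂₃ := by simp [S₁] }
        have : Epi φ.τ₁ := inferInstanceAs (Epi (𝟙 _))
        have : IsIso φ.τ₂ := inferInstanceAs (IsIso (𝟙 _))
        have : Mono φ.τ₃ := inferInstanceAs (Mono (Abelian.image.ι f))
        exact (ShortComplex.exact_iff_of_epi_of_isIso_of_mono φ).2 h
      mono_f := inferInstanceAs (Mono (kernel.ι f))
      epi_g := inferInstanceAs (Epi (Abelian.factorThruImage f)) }
  let S₂ : ShortComplex C :=
    ShortComplex.mk (Abelian.image.ι f) (cokernel.π f) (by simp)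
  have h₂ : S₂.ShortExact :=
    { exact := S₂.exact_of_f_is_kernel (kernelIsKernel (cokernel.π f))
      mono_f := inferInstanceAs (Mono (Abelian.image.ι f))
      epi_g := inferInstanceAs (Epi (cokernel.π f)) }
  exact ⟨fun hX => hT.mem₂ S₂ h₂ (hT.mem₃ S₁ h₁ hk hX) hc,
    fun hY => hT.mem₂ S₁ h₁ hk (hT.mem₁ S₂ h₂ hY hc)⟩

theorem mem_of_iso_map (P : ObjectProperty C) [P.IsSerreClass] (π : C ⥤ D)
    [π.IsLocalization P.isoModSerre]
    {T : Set C} (hT : IsThickAb T) (hPT : ∀ X, P X → X ∈ T)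
    {X Y : C} (e : π.obj X ≅ π.obj Y) (hX : X ∈ T) : Y ∈ T := by
  have := aux_additive P π
  obtain ⟨φ, hφ⟩ := Localization.exists_rightFraction π P.isoModSerre e.hom
  have hs := Localization.inverts π P.isoModSerre φ.s φ.hs
  have hf : π.map φ.f = π.map φ.s ≫ e.hom := by
    rw [hφ, MorphismProperty.RightFraction.map_s_comp_map]
  have : IsIso (π.map φ.f) := by rw [hf]; infer_instance
  have hf' := (ObjectProperty.SerreClassLocalization.isIso_map_iff π P φ.f).1 this
  have hs' := φ.hs
  exact (mem_iff_of_ker_coker hT φ.f (hPT _ hf'.1) (hPT _ hf'.2)).1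
    ((mem_iff_of_ker_coker hT φ.s (hPT _ hs'.1) (hPT _ hs'.2)).2 hX)

open scoped ZeroObject in
/-- The descent of a thick subcategory containing the Serre class is thick in the quotient. -/
theorem isThickAb_descent (P : ObjectProperty C) [P.IsSerreClass] (π : C ⥤ D)
    [π.IsLocalization P.isoModSerre]
    {T : Set C} (hT : IsThickAb T) (hPT : ∀ X, P X → X ∈ T) :
    IsThickAb (imageSet π T) := by
  have := aux_additive P π
  have := aux_preservesFiniteLimits P π
  have key : ∀ {X : C} {Y : D}, (π.obj X ≅ Y) → Y ∈ imageSet π T → X ∈ T := by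
    rintro X Y e ⟨X', hX', ⟨e'⟩⟩
    exact mem_of_iso_map P π hT hPT (e' ≪≫ e.symm) hX'
  constructor
  · rintro X Y e ⟨X', hX', ⟨e'⟩⟩
    exact ⟨X', hX', ⟨e' ≪≫ e⟩⟩
  · intro X hX
    exact ⟨0, hT.zero_mem (isZero_zero C),
      ⟨(π.map_isZero (isZero_zero C)).iso hX⟩⟩
  · rintro X Y ⟨s, r, hsr⟩ hY
    have := Localization.essSurj π P.isoModSerre
    have : IsSplitMono s := ⟨⟨⟨r, hsr⟩⟩⟩
    let S : ShortComplex D := ShortComplex.mk s (cokernel.π s) (by simp)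
    have hS : S.Exact := S.exact_of_g_is_cokernel (cokernelIsCokernel s)
    have : Epi S.g := inferInstanceAs (Epi (cokernel.π s))
    let i : Y ≅ X ⊞ cokernel s :=
      (ShortComplex.Splitting.ofExactOfRetraction S hS r hsr this).isoBinaryBiproduct
    have := preservesBinaryBiproducts_of_preservesBinaryProducts π
    let eX := π.objObjPreimageIso X
    let eK := π.objObjPreimageIso (cokernel s)
    have hm : (π.objPreimage X ⊞ π.objPreimage (cokernel s)) ∈ T :=
      key ((π.mapBiprod _ _) ≪≫ biprod.mapIso eX eK ≪≫ i.symm) hY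
    exact ⟨_, hT.retract_mem ⟨biprod.inl, biprod.fst, by simp⟩ hm, ⟨eX⟩⟩
  · intro S hS h₁ h₃
    obtain ⟨S', hS', ⟨e₁⟩, ⟨e₂⟩, ⟨e₃⟩⟩ := exists_shortExact_lift P π S hS
    exact ⟨_, hT.mem₂ S' hS' (key e₁ h₁) (key e₃ h₃), ⟨e₂⟩⟩
  · intro S hS h₂ h₃
    obtain ⟨S', hS', ⟨e₁⟩, ⟨e₂⟩, ⟨e₃⟩⟩ := exists_shortExact_lift P π S hS
    exact ⟨_, hT.mem₁ S' hS' (key e₂ h₂) (key e₃ h₃), ⟨e₁⟩⟩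
  · intro S hS h₁ h₂
    obtain ⟨S', hS', ⟨e₁⟩, ⟨e₂⟩, ⟨e₃⟩⟩ := exists_shortExact_lift P π S hS
    exact ⟨_, hT.mem₃ S' hS' (key e₁ h₁) (key e₂ h₂), ⟨e₃⟩⟩

theorem isThickIn_inter {T : Set C} (hT : IsThickAb T) (B : Set C) :
    IsThickIn B (T ∩ B) where
  subset := Set.inter_subset_right
  mem_of_iso e h hY := ⟨hT.mem_of_iso e h.1, hY⟩
  zero_mem h hX := ⟨hT.zero_mem h, hX⟩
  retract_mem h hB hX := ⟨hT.retract_mem h hB.1, hX⟩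
  mem₂ S hS h h₁ h₂ := ⟨hT.mem₂ S hS h₁.1 h₂.1, h⟩
  mem₁ S hS h h₁ h₂ := ⟨hT.mem₁ S hS h₁.1 h₂.1, h⟩
  mem₃ S hS h h₁ h₂ := ⟨hT.mem₃ S hS h₁.1 h₂.1, h⟩

/-- Let `B` be a Serre subcategory of `C` with quotient functor `π : C ⥤ D`.  If there
is an object `G_B` of `B` which classically generates the abelian category `B`, and an
object `G` of `D = C/B` which classically generates `D`, then for any `G'` in `C` with
`π(G') ≅ G`, the object `G_B ⊕ G'` classically generates `C`. -/
theorem thickClosure_biprod_eq_univ (B : Set C) (hB : IsSerre B)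
    (π : C ⥤ D) [π.IsLocalization (serreW B)]
    (GB : C) (hGB : GB ∈ B) (hGBgen : thickClosureIn B {GB} = B)
    (G : D) (hG : thickClosure {G} = Set.univ)
    (G' : C) (e : π.obj G' ≅ G) :
    thickClosure {GB ⊞ G'} = Set.univ := by
  let P : ObjectProperty C := fun X => X ∈ B
  have : P.IsSerreClass := serreClass_of_isSerre hB
  have : π.IsLocalization P.isoModSerre := inferInstanceAs (π.IsLocalization (serreW B))
  refine Set.eq_univ_of_forall fun X T hT hsub => ?_
  have hmem : (GB ⊞ G') ∈ T := hsub rfl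
  have h₁ : GB ∈ T := hT.retract_mem ⟨biprod.inl, biprod.fst, by simp⟩ hmem
  have h₂ : G' ∈ T := hT.retract_mem ⟨biprod.inr, biprod.snd, by simp⟩ hmem
  have hBT : ∀ Y, P Y → Y ∈ T := by
    intro Y hY
    have hY' : Y ∈ thickClosureIn B {GB} := by rw [hGBgen]; exact hY
    exact (hY' _ (isThickIn_inter hT B) (by rintro _ rfl; exact ⟨h₁, hGB⟩)).1
  have hX : π.obj X ∈ thickClosure {G} := by rw [hG]; trivial
  obtain ⟨X', hX', ⟨e'⟩⟩ := hX _ (isThickAb_descent P π hT hBT)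
    (by rintro _ rfl; exact ⟨G', h₂, ⟨e⟩⟩)
  exact mem_of_iso_map P π hT hBT e' hX'
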